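/- arXiv:2301.09134 — 2 statements merged into one kernel-verified Lean document; each statement's English description precedes it below -/
import Mathlib

section
/- Let F0 satisfy Assumption (A) and β ∈ (0, 1/2). Then there exists c_β > 0 such that for all c ≥ c_β the function g_{β,c}(r) = 4π√2 ∫₀^∞ √s F_{β,c}(r+s) ds satisfies the subdifferential inequality g_{β,c}(r) ≥ g_{β,c}(0) + g_{β,c}'(0) r for all r ∈ ℝ. (Note g_{β,c}(0) and g_{β,c}'(0) do not depend on c, since F_{β,c} = F0 on [0,∞).) -/
open MeasureTheory Real Set

noncomputable section

abbrev R3 : Type := EuclideanSpace ℝ (Fin 3)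

/-- g(r) = 4π√2 ∫₀^∞ √s F(r+s) ds -/
def gfun (F : ℝ → ℝ) (r : ℝ) : ℝ :=
  4 * π * Real.sqrt 2 * ∫ s in Ioi (0:ℝ), Real.sqrt s * F (r + s)

/-- Conditions (G) on g with exponent α. -/
def CondG (g : ℝ → ℝ) (α : ℝ) : Prop :=
  g 0 = 1 ∧
  ContDiff ℝ 2 g ∧
  (∀ r : ℝ, deriv g r < 0) ∧
  (∀ r : ℝ, g 0 + deriv g 0 * r ≤ g r) ∧
  ∃ C₁ : ℝ, 0 < C₁ ∧ ∃ C₂ : ℝ, 0 < C₂ ∧ ∀ r : ℝ,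
    g r - (g 0 + deriv g 0 * r) ≤ C₁ * |r| ^ α ∧
    |deriv g r - deriv g 0| ≤ C₂ * |r| ^ (α - 1)

/-- Assumption (A) on F0, with F0' its derivative on [0,∞). -/
def AssumptionA (F0 F0' : ℝ → ℝ) : Prop :=
  (∀ r, 0 ≤ r → 0 ≤ F0 r) ∧
  (∀ r, 0 ≤ r → HasDerivWithinAt F0 (F0' r) (Ici 0) r) ∧
  ContinuousOn F0' (Ici 0) ∧
  4 * π * Real.sqrt 2 * (∫ r in Ioi (0:ℝ), Real.sqrt r * F0 r) = 1 ∧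
  (∃ C : ℝ, 0 < C ∧ ∀ r, 0 ≤ r → |F0 r| + |F0' r| ≤ C / (1 + r ^ 3)) ∧
  (∀ r, 0 ≤ r → F0' r < 0)

/-- C¹_b : continuously differentiable, bounded together with the derivative. -/
def C1b (F : ℝ → ℝ) : Prop :=
  ContDiff ℝ 1 F ∧ ∃ M : ℝ, ∀ r : ℝ, |F r| ≤ M ∧ |deriv F r| ≤ M

/-- The Laplacian of φ at x. -/
def lap (φ : R3 → ℝ) (x : R3) : ℝ :=
  ∑ i : Fin 3, fderiv ℝ (fun y => fderiv ℝ φ y (EuclideanSpace.single i 1)) x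
    (EuclideanSpace.single i 1)

/-- Integral of φ against a signed measure. -/
def sintegral (μ : SignedMeasure R3) (φ : R3 → ℝ) : ℝ :=
  (∫ x, φ x ∂μ.toJordanDecomposition.posPart) -
  (∫ x, φ x ∂μ.toJordanDecomposition.negPart)

/-- φ is a C_c^∞ test function. -/
def IsTest (φ : R3 → ℝ) : Prop := ContDiff ℝ (⊤ : ℕ∞) φ ∧ HasCompactSupport φ

/-- Q is a weak solution of −ΔQ = g∘Q − 1 + μ. -/
def WeakSol (g : ℝ → ℝ) (μ : SignedMeasure R3) (Q : R3 → ℝ) : Prop :=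
  ∀ φ : R3 → ℝ, IsTest φ →
    -(∫ x, Q x * lap φ x) = (∫ x, (g (Q x) - 1) * φ x) + sintegral μ φ

/-- Q has a distributional gradient in L¹(ℝ³). -/
def HasL1Grad (Q : R3 → ℝ) : Prop :=
  ∃ G : R3 → EuclideanSpace ℝ (Fin 3), Integrable G ∧
    ∀ φ : R3 → ℝ, IsTest φ → ∀ i : Fin 3,
      ∫ x, Q x * fderiv ℝ φ x (EuclideanSpace.single i 1) = -∫ x, G x i * φ x

/-- The extension F_{β,c} of F0 to the negative half-line. -/
def Fbc (F0 F0' : ℝ → ℝ) (β c : ℝ) (r : ℝ) : ℝ :=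
  if 0 ≤ r then F0 r
  else c * r ^ 2 / (1 + r ^ 2) ^ ((β + 2) / 2) + Real.exp (-r ^ 2) * (F0 0 + F0' 0 * r)

/-- The Yukawa kernel Φ_σ, fundamental solution of σ − Δ on ℝ³. -/
def Phi (σ : ℝ) (x : R3) : ℝ := Real.exp (-Real.sqrt σ * ‖x‖) / (4 * π * ‖x‖)

/-- Convolution of Φ_σ with a signed measure μ. -/
def convPhiMeas (σ : ℝ) (μ : SignedMeasure R3) (x : R3) : ℝ :=
  (∫ y, Phi σ (x - y) ∂μ.toJordanDecomposition.posPart) -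
  (∫ y, Phi σ (x - y) ∂μ.toJordanDecomposition.negPart)

/-- Local uniform domination of `s ↦ √s * φ (r + s)` for `φ` decaying like `t⁻³` at `+∞`. -/
lemma exists_sqrt_mul_shift_bound {φ : ℝ → ℝ} (hφ : Continuous φ)
    (hdec : ∃ C : ℝ, ∀ t, 0 ≤ t → |φ t| ≤ C / (1 + t ^ 3)) (R : ℝ) :
    ∃ M : ℝ, ∀ r, |r| ≤ R → ∀ s, ‖√s * φ (r + s)‖ ≤ M * (1 + ‖s‖) ^ (-(3 / 2 : ℝ)) := by
  obtain ⟨C, hC⟩ := hdec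
  obtain ⟨B, hB⟩ := (isCompact_Icc (a := -R) (b := 0)).exists_bound_of_continuousOn hφ.continuousOn
  have hC0 : 0 ≤ C := by simpa using (abs_nonneg _).trans (hC 0 le_rfl)
  refine ⟨(C * (3 + 2 * R ^ 2) + |B| * (1 + R ^ 2)) * 2, fun r hr s => ?_⟩
  have hR : 0 ≤ R := (abs_nonneg r).trans hr
  obtain ⟨hr1, hr2⟩ := abs_le.1 hr
  have hM : 0 ≤ C * (3 + 2 * R ^ 2) + |B| * (1 + R ^ 2) := by positivity
  rcases le_or_gt s 0 with hs | hs
  · rw [sqrt_eq_zero_of_nonpos hs]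
    simp only [zero_mul, norm_zero]
    positivity
  have hst : 0 ≤ s ∧ s ≤ r + s + R := ⟨hs.le, by linarith⟩
  have key : |φ (r + s)| * (1 + s ^ 2) ≤ C * (3 + 2 * R ^ 2) + |B| * (1 + R ^ 2) := by
    rcases le_total 0 (r + s) with ht | ht
    · have h1 := hC _ ht
      have hp : 0 < 1 + (r + s) ^ 3 := by positivity
      rw [le_div_iff₀ hp] at h1
      have h2 : 1 + s ^ 2 ≤ (3 + 2 * R ^ 2) * (1 + (r + s) ^ 3) := by
        generalize r + s = t at *
        have h3 : s ^ 2 ≤ (t + R) ^ 2 := by gcongr; exact hst.2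
        have h4 : t ^ 2 ≤ 1 + t ^ 3 := by
          nlinarith [mul_nonneg (sq_nonneg (t - 1)) ht, sq_nonneg (t - 1)]
        nlinarith [sq_nonneg (t - R), mul_nonneg (sq_nonneg R) (pow_nonneg ht 3),
          pow_nonneg ht 3]
      calc |φ (r + s)| * (1 + s ^ 2)
          ≤ |φ (r + s)| * ((3 + 2 * R ^ 2) * (1 + (r + s) ^ 3)) := by gcongr
        _ = |φ (r + s)| * (1 + (r + s) ^ 3) * (3 + 2 * R ^ 2) := by ring
        _ ≤ C * (3 + 2 * R ^ 2) := by gcongr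
        _ ≤ _ := le_add_of_nonneg_right (by positivity)
    · have h1 : |φ (r + s)| ≤ |B| := (hB _ ⟨by linarith, ht⟩).trans (le_abs_self B)
      have h2 : s ^ 2 ≤ R ^ 2 := by gcongr; linarith
      calc |φ (r + s)| * (1 + s ^ 2) ≤ |B| * (1 + R ^ 2) := by gcongr
        _ ≤ _ := le_add_of_nonneg_left (by positivity)
  have h1s : 0 < 1 + s := by linarith
  rw [norm_mul, norm_of_nonneg (sqrt_nonneg s), norm_of_nonneg hs.le, Real.norm_eq_abs]
  have hrp : (1 + s) ^ (-(3 / 2 : ℝ)) = √(1 + s) / (1 + s) ^ 2 := by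
    rw [sqrt_eq_rpow, ← rpow_natCast, ← rpow_sub h1s]; norm_num
  rw [hrp]
  have h5 : √s ≤ √(1 + s) := sqrt_le_sqrt (by linarith)
  have h6 : |φ (r + s)| ≤ (C * (3 + 2 * R ^ 2) + |B| * (1 + R ^ 2)) * 2 / (1 + s) ^ 2 := by
    rw [le_div_iff₀ (by positivity)]
    nlinarith [mul_nonneg (abs_nonneg (φ (r + s))) (sq_nonneg (1 - s))]
  calc √s * |φ (r + s)|
      ≤ √(1 + s) * ((C * (3 + 2 * R ^ 2) + |B| * (1 + R ^ 2)) * 2 / (1 + s) ^ 2) := by gcongr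
    _ = _ := by ring

lemma integrable_one_add_norm_rpow_neg_three_halves :
    Integrable (fun s : ℝ => (1 + ‖s‖) ^ (-(3 / 2 : ℝ))) :=
  integrable_one_add_norm (by norm_num)

lemma integrable_sqrt_mul_shift {φ : ℝ → ℝ} (hφ : Continuous φ)
    (hdec : ∃ C : ℝ, ∀ t, 0 ≤ t → |φ t| ≤ C / (1 + t ^ 3)) (r : ℝ) :
    Integrable (fun s => √s * φ (r + s)) := by
  obtain ⟨M, hM⟩ := exists_sqrt_mul_shift_bound hφ hdec |r|
  exact (integrable_one_add_norm_rpow_neg_three_halves.const_mul M).mono'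
    (by fun_prop) (Filter.Eventually.of_forall (hM r le_rfl))

lemma gfun_eq_integral (F : ℝ → ℝ) (r : ℝ) :
    gfun F r = 4 * π * √2 * ∫ s, √s * F (r + s) := by
  rw [gfun, setIntegral_eq_integral_of_forall_compl_eq_zero]
  intro s hs
  rw [sqrt_eq_zero_of_nonpos (not_lt.1 hs), zero_mul]

lemma hasDerivAt_gfun {F F' : ℝ → ℝ} (hF : ∀ t, HasDerivAt F (F' t) t) (hF' : Continuous F')
    (hdec : ∃ C : ℝ, ∀ t, 0 ≤ t → |F t| ≤ C / (1 + t ^ 3))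
    (hdec' : ∃ C : ℝ, ∀ t, 0 ≤ t → |F' t| ≤ C / (1 + t ^ 3)) (r : ℝ) :
    HasDerivAt (gfun F) (gfun F' r) r := by
  have hFc : Continuous F := continuous_iff_continuousAt.2 fun t => (hF t).continuousAt
  rw [gfun_eq_integral, funext (gfun_eq_integral F)]
  refine HasDerivAt.const_mul _ ?_
  obtain ⟨M, hM⟩ := exists_sqrt_mul_shift_bound hF' hdec' (|r| + 1)
  refine (hasDerivAt_integral_of_dominated_loc_of_deriv_le (μ := volume)
    (F := fun x s => √s * F (x + s)) (F' := fun x s => √s * F' (x + s))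
    (bound := fun s => M * (1 + ‖s‖) ^ (-(3 / 2 : ℝ)))
    (Metric.ball_mem_nhds r one_pos) ?_ ?_ ?_ ?_ ?_ ?_).2
  · exact Filter.Eventually.of_forall fun x => by fun_prop
  · exact integrable_sqrt_mul_shift hFc hdec r
  · fun_prop
  · refine Filter.Eventually.of_forall fun s x hx => hM x ?_ s
    rw [Metric.mem_ball, Real.dist_eq] at hx
    have := abs_add_le (x - r) r
    rw [sub_add_cancel] at this
    linarith
  · exact integrable_one_add_norm_rpow_neg_three_halves.const_mul M
  · exact Filter.Eventually.of_forall fun s x _ => ((hF (x + s)).comp_add_const x s).const_mul _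

/-- If `F` is nonincreasing on `[-δ, ∞)`, then `gfun F` lies above its tangent at `0` there. -/
lemma gfun_tangent_le {F F' : ℝ → ℝ} (hF : ∀ t, HasDerivAt F (F' t) t) (hF' : Continuous F')
    (hdec : ∃ C : ℝ, ∀ t, 0 ≤ t → |F t| ≤ C / (1 + t ^ 3))
    (hdec' : ∃ C : ℝ, ∀ t, 0 ≤ t → |F' t| ≤ C / (1 + t ^ 3))
    {δ : ℝ} (hδ : 0 ≤ δ) (hneg : ∀ t, -δ ≤ t → F' t ≤ 0) {r : ℝ} (hr : -δ ≤ r) :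
    gfun F 0 + gfun F' 0 * r ≤ gfun F r := by
  have hd := hasDerivAt_gfun hF hF' hdec hdec'
  have hshift (x : ℝ) : ∫ s, √s * F' (x + s) = ∫ t, √(t - x) * F' t := by
    rw [← integral_add_left_eq_self (fun t => √(t - x) * F' t) x]
    simp
  have hint (x : ℝ) : Integrable (fun t => √(t - x) * F' t) := by
    simpa using (integrable_sqrt_mul_shift hF' hdec' x).comp_sub_right x
  have hmono {x y : ℝ} (h : ∀ t, √(t - x) * F' t ≤ √(t - y) * F' t) :
      gfun F' x ≤ gfun F' y := by
    rw [gfun_eq_integral, gfun_eq_integral, hshift, hshift]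
    exact mul_le_mul_of_nonneg_left (integral_mono (hint x) (hint y) h) (by positivity)
  have hφ (x : ℝ) : HasDerivAt (fun x => gfun F x - gfun F' 0 * x) (gfun F' x - gfun F' 0) x := by
    have hlin : HasDerivAt (fun x => gfun F' 0 * x) (gfun F' 0) x := by
      simpa using (hasDerivAt_id x).const_mul (gfun F' 0)
    exact (hd x).sub hlin
  have hφc : Continuous (fun x => gfun F x - gfun F' 0 * x) :=
    continuous_iff_continuousAt.2 fun x => (hφ x).continuousAt
  have hφd : Differentiable ℝ (fun x => gfun F x - gfun F' 0 * x) :=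
    fun x => (hφ x).differentiableAt
  suffices h : gfun F 0 - gfun F' 0 * 0 ≤ gfun F r - gfun F' 0 * r by linarith
  rcases le_total 0 r with h0 | h0
  · refine monotoneOn_of_deriv_nonneg (convex_Ici 0) hφc.continuousOn hφd.differentiableOn
      (fun x hx => ?_) (mem_Ici.2 le_rfl) (mem_Ici.2 h0) h0
    rw [interior_Ici, mem_Ioi] at hx
    rw [(hφ x).deriv, sub_nonneg]
    refine hmono fun t => ?_
    rcases le_total t 0 with ht | ht
    · rw [sqrt_eq_zero_of_nonpos (by linarith : t - 0 ≤ 0),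
        sqrt_eq_zero_of_nonpos (by linarith : t - x ≤ 0)]
    · exact mul_le_mul_of_nonpos_right (sqrt_le_sqrt (by linarith)) (hneg t (by linarith))
  · refine antitoneOn_of_deriv_nonpos (convex_Icc (-δ) 0) hφc.continuousOn hφd.differentiableOn
      (fun x hx => ?_) ⟨hr, h0⟩ ⟨by linarith, le_rfl⟩ h0
    rw [interior_Icc, mem_Ioo] at hx
    rw [(hφ x).deriv, sub_nonpos]
    refine hmono fun t => ?_
    rcases le_total t (-δ) with ht | ht
    · rw [sqrt_eq_zero_of_nonpos (by linarith : t - 0 ≤ 0),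
        sqrt_eq_zero_of_nonpos (by linarith : t - x ≤ 0)]
    · exact mul_le_mul_of_nonpos_right (sqrt_le_sqrt (by linarith)) (hneg t ht)

/-- Derivative of `r ^ 2 / (1 + r ^ 2) ^ p`. -/
def tailDeriv (p r : ℝ) : ℝ :=
  (2 * r * (1 + r ^ 2) ^ p - r ^ 2 * (2 * r * p * (1 + r ^ 2) ^ (p - 1))) /
    ((1 + r ^ 2) ^ p) ^ 2

lemma hasDerivAt_tail (p r : ℝ) :
    HasDerivAt (fun r : ℝ => r ^ 2 / (1 + r ^ 2) ^ p) (tailDeriv p r) r := by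
  have hsq : HasDerivAt (fun r : ℝ => r ^ 2) (2 * r) r := by simpa using hasDerivAt_pow 2 r
  exact hsq.div ((hsq.const_add 1).rpow_const (Or.inl (by positivity))) (by positivity)

lemma continuous_tailDeriv (p : ℝ) : Continuous (tailDeriv p) := by
  have h (q : ℝ) : Continuous fun r : ℝ => (1 + r ^ 2) ^ q :=
    Continuous.rpow_const (by fun_prop) fun r => Or.inl (by positivity)
  have h1 := h p
  have h2 := h (p - 1)
  unfold tailDeriv
  exact Continuous.div (by fun_prop) (by fun_prop) fun r => by positivity

lemma tailDeriv_nonpos {p r : ℝ} (hp : p ≤ 2) (hr : r ≤ 0) (hr' : -1 ≤ r) :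
    tailDeriv p r ≤ 0 := by
  refine div_nonpos_of_nonpos_of_nonneg ?_ (by positivity)
  have hpos : 0 < 1 + r ^ 2 := by positivity
  have h1 : (1 + r ^ 2) ^ p = (1 + r ^ 2) ^ (p - 1) * (1 + r ^ 2) := by
    rw [← rpow_add_one hpos.ne', sub_add_cancel]
  have h2 : 0 ≤ 1 + r ^ 2 - p * r ^ 2 := by nlinarith
  have h3 : 0 ≤ (1 + r ^ 2) ^ (p - 1) := by positivity
  rw [h1]
  nlinarith [mul_nonneg (mul_nonneg h3 h2) (neg_nonneg.2 hr)]

/-- The derivative of `Fbc F0 F0' β c`. -/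
def FbcDeriv (F0 F0' : ℝ → ℝ) (β c : ℝ) (r : ℝ) : ℝ :=
  if 0 ≤ r then F0' r
  else c * tailDeriv ((β + 2) / 2) r +
    Real.exp (-r ^ 2) * (F0' 0 - 2 * r * (F0 0 + F0' 0 * r))

lemma hasDerivAt_Fbc {F0 F0' : ℝ → ℝ}
    (hF : ∀ r, 0 ≤ r → HasDerivWithinAt F0 (F0' r) (Ici 0) r) (β c r : ℝ) :
    HasDerivAt (Fbc F0 F0' β c) (FbcDeriv F0 F0' β c r) r := by
  have hleft (x : ℝ) : HasDerivAt
      (fun r => c * r ^ 2 / (1 + r ^ 2) ^ ((β + 2) / 2) + Real.exp (-r ^ 2) * (F0 0 + F0' 0 * r))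
      (c * tailDeriv ((β + 2) / 2) x +
        Real.exp (-x ^ 2) * (F0' 0 - 2 * x * (F0 0 + F0' 0 * x))) x := by
    have hsq : HasDerivAt (fun r : ℝ => -r ^ 2) (-(2 * x)) x := by
      have h : HasDerivAt (fun r : ℝ => r ^ 2) (2 * x) x := by simpa using hasDerivAt_pow 2 x
      exact h.neg
    have hlin : HasDerivAt (fun r : ℝ => F0 0 + F0' 0 * r) (F0' 0) x := by
      simpa using ((hasDerivAt_id x).const_mul (F0' 0)).const_add (F0 0)
    simp only [mul_div_assoc]
    refine (((hasDerivAt_tail ((β + 2) / 2) x).const_mul c).add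
      (hsq.exp.mul hlin)).congr_deriv ?_
    ring
  have hright {x : ℝ} (hx : 0 ≤ x) : HasDerivWithinAt (Fbc F0 F0' β c) (F0' x) (Ici 0) x :=
    (hF x hx).congr (fun y hy => if_pos hy) (if_pos hx)
  rcases lt_trichotomy r 0 with h | rfl | h
  · rw [FbcDeriv, if_neg h.not_ge]
    refine (hleft r).congr_of_eventuallyEq ?_
    filter_upwards [gt_mem_nhds h] with y hy using if_neg (not_le.2 hy)
  · have h1 := hright le_rfl
    have h2 : HasDerivWithinAt (Fbc F0 F0' β c) (F0' 0) (Iic 0) 0 := by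
      have h3 := (hleft 0).hasDerivWithinAt (s := Iic 0)
      simp only [tailDeriv] at h3
      refine (h3.congr_deriv (by simp)).congr (fun y hy => ?_) (by simp [Fbc])
      rcases (mem_Iic.1 hy).lt_or_eq with hy | rfl
      · exact if_neg (not_le.2 hy)
      · simp [Fbc]
    have h3 := h2.union h1
    rw [Iic_union_Ici, hasDerivWithinAt_univ] at h3
    rwa [FbcDeriv, if_pos le_rfl]
  · rw [FbcDeriv, if_pos h.le]
    exact (hright h.le).hasDerivAt (Ici_mem_nhds h)

lemma continuous_FbcDeriv {F0 F0' : ℝ → ℝ} (hF : ContinuousOn F0' (Ici 0)) (β c : ℝ) :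
    Continuous (FbcDeriv F0 F0' β c) := by
  have h := continuous_tailDeriv ((β + 2) / 2)
  refine continuous_if_le continuous_const continuous_id hF
    (Continuous.continuousOn (by fun_prop)) fun x hx => ?_
  obtain rfl : 0 = x := hx
  simp [tailDeriv]

/-- Near `0`, `Fbc` is nonincreasing on the negative side, uniformly in `c ≥ 0`. -/
lemma exists_FbcDeriv_nonpos {F0 F0' : ℝ → ℝ}
    (hneg : ∀ r, 0 ≤ r → F0' r < 0) {β : ℝ} (hβ : β ≤ 2) :
    ∃ δ : ℝ, 0 < δ ∧ ∀ c : ℝ, 0 ≤ c → ∀ t, -δ ≤ t → FbcDeriv F0 F0' β c t ≤ 0 := by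
  have h0 := hneg 0 le_rfl
  have hcont : Continuous fun r => F0' 0 - 2 * r * (F0 0 + F0' 0 * r) := by fun_prop
  have hev := hcont.continuousAt.eventually_lt (x₀ := 0) continuousAt_const
    (by simpa using h0 : F0' 0 - 2 * 0 * (F0 0 + F0' 0 * 0) < (0 : ℝ))
  obtain ⟨ε, hε, hball⟩ := Metric.eventually_nhds_iff.1 hev
  refine ⟨min (ε / 2) 1, by positivity, fun c hc t ht => ?_⟩
  unfold FbcDeriv
  split_ifs with h
  · exact (hneg t h).le
  have h1 := min_le_left (ε / 2) 1
  have h2 := min_le_right (ε / 2) 1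
  have h3 := @hball t (by rw [Real.dist_eq, sub_zero, abs_lt]; constructor <;> linarith)
  have h4 := tailDeriv_nonpos (p := (β + 2) / 2) (by linarith) (not_le.1 h).le (by linarith)
  exact add_nonpos (mul_nonpos_of_nonneg_of_nonpos hc h4)
    (mul_nonpos_of_nonneg_of_nonpos (exp_nonneg _) h3.le)

lemma Fbc_nonneg {F0 F0' : ℝ → ℝ} (hF0 : ∀ r, 0 ≤ r → 0 ≤ F0 r) (hF0' : F0' 0 ≤ 0)
    (β : ℝ) {c : ℝ} (hc : 0 ≤ c) (t : ℝ) : 0 ≤ Fbc F0 F0' β c t := by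
  unfold Fbc
  split_ifs with h
  · exact hF0 t h
  have h1 := hF0 0 le_rfl
  have h2 := mul_nonneg_of_nonpos_of_nonpos hF0' (not_le.1 h).le
  positivity

/-- Lower bound for the algebraic tail away from `0`. -/
lemma tail_lower_bound {β η x : ℝ} (hβ : β ≤ 1 / 2) (hη : 0 < η) (hx : η ≤ x) :
    ((1 + 1 / η ^ 2) ^ 2)⁻¹ ≤ √x * (x ^ 2 / (1 + x ^ 2) ^ ((β + 2) / 2)) := by
  have hx0 : 0 < x := hη.trans_le hx
  set E : ℝ := 1 + 1 / η ^ 2 with hE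
  have hE1 : 1 ≤ E := le_add_of_nonneg_right (by positivity)
  have h1 : 1 + x ^ 2 ≤ E * x ^ 2 := by
    have : 1 ≤ 1 / η ^ 2 * x ^ 2 := by
      rw [one_div_mul_eq_div, one_le_div (by positivity)]
      gcongr
    rw [hE]; linarith
  have h2 : (1 + x ^ 2) ^ ((β + 2) / 2) ≤ E ^ 2 * (x ^ 2 * √x) := by
    calc (1 + x ^ 2) ^ ((β + 2) / 2) ≤ (1 + x ^ 2) ^ (5 / 4 : ℝ) :=
          rpow_le_rpow_of_exponent_le (by nlinarith) (by linarith)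
      _ ≤ (E * x ^ 2) ^ (5 / 4 : ℝ) := by gcongr
      _ = E ^ (5 / 4 : ℝ) * (x ^ 2 * √x) := by
          rw [mul_rpow (by positivity) (by positivity), sqrt_eq_rpow, ← rpow_natCast x 2,
            ← rpow_mul hx0.le, ← rpow_add hx0]
          norm_num
      _ ≤ E ^ (2 : ℝ) * (x ^ 2 * √x) := by gcongr; norm_num
      _ = _ := by norm_cast
  have hs : 0 < √x := sqrt_pos.2 hx0
  rw [inv_eq_one_div, ← mul_div_assoc, div_le_div_iff₀ (by positivity) (by positivity)]
  linarith

/-- Linear lower bound for `gfun (Fbc F0 F0' β c)` far to the left, proportional to `c`. -/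
lemma gfun_Fbc_lower_bound {F0 F0' : ℝ → ℝ} (hF0 : ∀ r, 0 ≤ r → 0 ≤ F0 r) (hF0' : F0' 0 ≤ 0)
    {β c δ ρ : ℝ} (hβ : β ≤ 1 / 2) (hc : 0 ≤ c) (hδ : 0 < δ) (hρ : δ ≤ ρ)
    (hint : Integrable fun s => √s * Fbc F0 F0' β c (-ρ + s)) :
    4 * π * √2 * (c * ((1 + 1 / (δ / 4) ^ 2) ^ 2)⁻¹ * (ρ / 4)) ≤
      gfun (Fbc F0 F0' β c) (-ρ) := by
  have hρ0 : 0 < ρ := hδ.trans_le hρ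
  rw [gfun_eq_integral]
  gcongr
  set κ := ((1 + 1 / (δ / 4) ^ 2) ^ 2)⁻¹
  have hpt : ∀ s ∈ Icc (ρ / 2) (3 * ρ / 4), c * κ ≤ √s * Fbc F0 F0' β c (-ρ + s) := by
    intro s hs
    obtain ⟨hs1, hs2⟩ := hs
    have hx : δ / 4 ≤ ρ - s := by linarith
    have h1 := tail_lower_bound hβ (by positivity : 0 < δ / 4) hx
    have h2 : √(ρ - s) ≤ √s := sqrt_le_sqrt (by linarith)
    have hxn : -ρ + s < 0 := by linarith
    have h3 : c * ((ρ - s) ^ 2 / (1 + (ρ - s) ^ 2) ^ ((β + 2) / 2)) ≤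
        Fbc F0 F0' β c (-ρ + s) := by
      rw [Fbc, if_neg (not_le.2 hxn), mul_div_assoc,
        (by ring : (-ρ + s) ^ 2 = (ρ - s) ^ 2)]
      have h4 := hF0 0 le_rfl
      have h5 := mul_nonneg_of_nonpos_of_nonpos hF0' hxn.le
      exact le_add_of_nonneg_right (by positivity)
    calc c * κ ≤ c * (√(ρ - s) * ((ρ - s) ^ 2 / (1 + (ρ - s) ^ 2) ^ ((β + 2) / 2))) := by gcongr
      _ = √(ρ - s) * (c * ((ρ - s) ^ 2 / (1 + (ρ - s) ^ 2) ^ ((β + 2) / 2))) := by ring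
      _ ≤ _ := by gcongr
  calc c * κ * (ρ / 4) = ∫ _ in Icc (ρ / 2) (3 * ρ / 4), c * κ := by
        rw [setIntegral_const, Real.volume_real_Icc_of_le (by linarith), smul_eq_mul]
        ring
    _ ≤ ∫ s in Icc (ρ / 2) (3 * ρ / 4), √s * Fbc F0 F0' β c (-ρ + s) :=
        setIntegral_mono_on (integrableOn_const (by simp)) hint.integrableOn measurableSet_Icc hpt
    _ ≤ _ := setIntegral_le_integral hint (Filter.Eventually.of_forall fun s =>
        mul_nonneg (sqrt_nonneg s) (Fbc_nonneg hF0 hF0' β hc _))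

/-- Step 4 of Lemma 2.1 (subdifferential inequality): there exists c_β > 0 such that
for all c ≥ c_β the function g_{β,c} satisfies g_{β,c}(r) ≥ g_{β,c}(0) + g_{β,c}'(0)·r
for all r ∈ ℝ. -/
theorem gfun_subdifferential_inequality
    (F0 F0' : ℝ → ℝ) (β : ℝ)
    (hF0 : AssumptionA F0 F0') (hβ : 0 < β) (hβ' : β < 1 / 2) :
    ∃ cβ : ℝ, 0 < cβ ∧ ∀ c : ℝ, cβ ≤ c → ∀ r : ℝ,
      gfun (Fbc F0 F0' β c) 0 + deriv (gfun (Fbc F0 F0' β c)) 0 * r ≤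
        gfun (Fbc F0 F0' β c) r := by
  obtain ⟨hpos, hder, hcont, -, ⟨C, -, hC⟩, hneg⟩ := hF0
  have h0 := hneg 0 le_rfl
  obtain ⟨δ, hδ, hδneg⟩ := exists_FbcDeriv_nonpos hneg (by linarith : β ≤ 2)
  have hd (c t : ℝ) := hasDerivAt_Fbc hder β c t
  have hdc (c : ℝ) := continuous_FbcDeriv (F0 := F0) hcont β c
  have hFc (c : ℝ) : Continuous (Fbc F0 F0' β c) :=
    continuous_iff_continuousAt.2 fun t => (hd c t).continuousAt
  have hdec (c : ℝ) : ∃ C : ℝ, ∀ t, 0 ≤ t → |Fbc F0 F0' β c t| ≤ C / (1 + t ^ 3) := by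
    refine ⟨C, fun t ht => ?_⟩
    rw [Fbc, if_pos ht]
    linarith [hC t ht, abs_nonneg (F0' t)]
  have hdec' (c : ℝ) : ∃ C : ℝ, ∀ t, 0 ≤ t → |FbcDeriv F0 F0' β c t| ≤ C / (1 + t ^ 3) := by
    refine ⟨C, fun t ht => ?_⟩
    rw [FbcDeriv, if_pos ht]
    linarith [hC t ht, abs_nonneg (F0 t)]
  have hg0 (c : ℝ) : gfun (Fbc F0 F0' β c) 0 = gfun F0 0 := by
    unfold gfun
    congr 1
    refine setIntegral_congr_fun measurableSet_Ioi fun s hs => ?_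
    simp [Fbc, (mem_Ioi.1 hs).le]
  have hg0' (c : ℝ) : gfun (FbcDeriv F0 F0' β c) 0 = gfun F0' 0 := by
    unfold gfun
    congr 1
    refine setIntegral_congr_fun measurableSet_Ioi fun s hs => ?_
    simp [FbcDeriv, (mem_Ioi.1 hs).le]
  set κ : ℝ := ((1 + 1 / (δ / 4) ^ 2) ^ 2)⁻¹ with hκ
  have hκ0 : 0 < κ := by positivity
  set K : ℝ := 4 * π * √2 with hK
  have hK0 : 0 < K := by positivity
  set N : ℝ := 4 * (|gfun F0 0| / δ + |gfun F0' 0| + 1) / (K * κ) with hN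
  have hN0 : 0 < N := by positivity
  refine ⟨N, hN0, fun c hc r => ?_⟩
  have hc0 : 0 ≤ c := hN0.le.trans hc
  rw [(hasDerivAt_gfun (hd c) (hdc c) (hdec c) (hdec' c) 0).deriv]
  rcases le_total (-δ) r with hr | hr
  · exact gfun_tangent_le (hd c) (hdc c) (hdec c) (hdec' c) hδ.le (hδneg c hc0) hr
  rw [hg0, hg0']
  obtain ⟨ρ, rfl⟩ : ∃ ρ, r = -ρ := ⟨-r, by ring⟩
  have hρ : δ ≤ ρ := by linarith
  have hρ0 : 0 < ρ := hδ.trans_le hρ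
  refine le_trans ?_ (gfun_Fbc_lower_bound hpos h0.le hβ'.le hc0 hδ hρ
    (integrable_sqrt_mul_shift (hFc c) (hdec c) _))
  have h1 : 4 * (|gfun F0 0| / δ + |gfun F0' 0| + 1) ≤ c * (K * κ) :=
    (div_le_iff₀ (by positivity)).1 hc
  have h2 : |gfun F0 0| ≤ |gfun F0 0| / δ * ρ := by
    rw [div_mul_eq_mul_div, le_div_iff₀ hδ]
    gcongr
  have h3 : -gfun F0' 0 * ρ ≤ |gfun F0' 0| * ρ := by
    gcongr
    exact neg_le_abs _
  calc gfun F0 0 + gfun F0' 0 * -ρ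
      ≤ (|gfun F0 0| / δ + |gfun F0' 0| + 1) * ρ := by
        linarith [le_abs_self (gfun F0 0)]
    _ ≤ c * (K * κ) / 4 * ρ := by
        gcongr
        linarith
    _ = _ := by ring


end
end

section
/- Let F0 satisfy Assumption (A), β ∈ (0, 1/2), c > 0, and set α = 3/2 − β. Then there exist constants C₁, C₂ > 0 such that the function g_{β,c}(r) = 4π√2 ∫₀^∞ √s F_{β,c}(r+s) ds satisfies, for all r ∈ ℝ: g_{β,c}(r) − (g_{β,c}(0) + g_{β,c}'(0) r) ≤ C₁ |r|^α and |g_{β,c}'(r) − g_{β,c}'(0)| ≤ C₂ |r|^{α−1}. -/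
open MeasureTheory Real Set

noncomputable section

/-- `F` decays cubically at `+∞`, uniformly under translations. -/
def TailDecay (F : ℝ → ℝ) : Prop :=
  ∀ a, 0 ≤ a → ∃ K, 0 ≤ K ∧ ∀ s, 0 ≤ s → ∀ x, s - a ≤ x → |F x| ≤ K * ((1 + s) ^ 3)⁻¹

theorem integrable_inv_one_add_abs_pow {n : ℕ} (hn : 1 < n) :
    Integrable (fun s : ℝ => ((1 + |s|) ^ n)⁻¹) := by
  have h := integrable_one_add_norm (E := ℝ) (μ := volume) (r := n) (by simpa using hn)
  refine h.congr (Filter.Eventually.of_forall fun s => ?_)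
  simp only [Real.norm_eq_abs]
  rw [Real.rpow_neg (by positivity), Real.rpow_natCast]

theorem integrableOn_sqrt_mul_inv_cube :
    IntegrableOn (fun s : ℝ => √s * ((1 + s) ^ 3)⁻¹) (Ioi 0) := by
  refine Integrable.mono' (integrable_inv_one_add_abs_pow one_lt_two).integrableOn
    (by fun_prop) ?_
  filter_upwards [self_mem_ae_restrict measurableSet_Ioi] with s hs
  have hs : 0 < s := hs
  rw [norm_of_nonneg (by positivity), abs_of_pos hs, pow_succ (1 + s) 2, mul_inv]
  have h1 : √s ≤ 1 + s := Real.sqrt_le_iff.2 ⟨by positivity, by nlinarith⟩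
  have h2 : √s * (1 + s)⁻¹ ≤ 1 := by
    rw [← div_eq_mul_inv]; exact (div_le_one (by positivity)).2 h1
  have h3 : 0 ≤ ((1 + s) ^ 2)⁻¹ := by positivity
  nlinarith

theorem inv_sqrt_eq_rpow {s : ℝ} (hs : 0 ≤ s) : (√s)⁻¹ = s ^ (-(1 / 2) : ℝ) := by
  rw [Real.sqrt_eq_rpow, Real.rpow_neg hs]

theorem integrableOn_inv_sqrt_mul_inv_cube :
    IntegrableOn (fun s : ℝ => (√s)⁻¹ * ((1 + s) ^ 3)⁻¹) (Ioi 0) := by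
  rw [← Ioc_union_Ioi_eq_Ioi (zero_le_one' ℝ)]
  refine IntegrableOn.union ?_ ?_
  · have h := (intervalIntegral.intervalIntegrable_rpow' (a := 0) (b := 1)
      (r := (-(1 / 2) : ℝ)) (by norm_num)).1
    refine Integrable.mono' h (by fun_prop) ?_
    filter_upwards [self_mem_ae_restrict measurableSet_Ioc] with s hs
    have hs0 : 0 < s := hs.1
    rw [norm_of_nonneg (by positivity), ← inv_sqrt_eq_rpow hs0.le]
    exact mul_le_of_le_one_right (by positivity)
      (inv_le_one_of_one_le₀ (one_le_pow₀ (by linarith)))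
  · refine Integrable.mono' (integrable_inv_one_add_abs_pow (n := 3) (by norm_num)).integrableOn
      (by fun_prop) ?_
    filter_upwards [self_mem_ae_restrict measurableSet_Ioi] with s hs
    have hs1 : 1 < s := hs
    have hs0 : 0 < s := by linarith
    rw [norm_of_nonneg (by positivity), abs_of_pos hs0]
    exact mul_le_of_le_one_left (by positivity)
      (inv_le_one_of_one_le₀ (Real.one_le_sqrt.2 hs1.le))

/-- A weight times a translate of a function with cubic tail decay is integrable. -/
theorem TailDecay.integrableOn_mul {F w : ℝ → ℝ} (h : TailDecay F) (hF : Measurable F)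
    (hw : Measurable w) (hw0 : ∀ s, 0 ≤ w s)
    (hwi : IntegrableOn (fun s : ℝ => w s * ((1 + s) ^ 3)⁻¹) (Ioi 0)) (r : ℝ) :
    IntegrableOn (fun s => w s * F (r + s)) (Ioi 0) := by
  obtain ⟨K, hK, hb⟩ := h |r| (abs_nonneg r)
  refine Integrable.mono' (hwi.const_mul K) (by fun_prop) ?_
  filter_upwards [self_mem_ae_restrict measurableSet_Ioi] with s hs
  rw [norm_mul, Real.norm_eq_abs, Real.norm_eq_abs, abs_of_nonneg (hw0 s)]
  have := hb s (le_of_lt hs) (r + s) (by linarith [neg_abs_le r])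
  calc w s * |F (r + s)| ≤ w s * (K * ((1 + s) ^ 3)⁻¹) := by gcongr; exact hw0 s
    _ = _ := by ring

theorem TailDecay.tendsto_sqrt_mul {F : ℝ → ℝ} (h : TailDecay F) (r : ℝ) :
    Filter.Tendsto (fun s => √s * F (r + s)) Filter.atTop (nhds 0) := by
  obtain ⟨K, hK, hb⟩ := h |r| (abs_nonneg r)
  have hlim : Filter.Tendsto (fun s : ℝ => K * s⁻¹) Filter.atTop (nhds 0) := by
    simpa using (tendsto_inv_atTop_zero (𝕜 := ℝ)).const_mul K
  refine squeeze_zero_norm' ?_ hlim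
  filter_upwards [Filter.eventually_gt_atTop 0] with s hs
  rw [norm_mul, Real.norm_eq_abs, Real.norm_eq_abs, abs_of_nonneg (sqrt_nonneg s)]
  have h1 := hb s hs.le (r + s) (by linarith [neg_abs_le r])
  have h2 : √s ≤ 1 + s := Real.sqrt_le_iff.2 ⟨by positivity, by nlinarith⟩
  calc √s * |F (r + s)| ≤ (1 + s) * (K * ((1 + s) ^ 3)⁻¹) := by gcongr
    _ = K * ((1 + s) ^ 2)⁻¹ := by field_simp
    _ ≤ K * s⁻¹ := by gcongr; nlinarith

theorem integral_sqrt_mul_deriv {F : ℝ → ℝ} (hF : Differentiable ℝ F) (h0 : TailDecay F)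
    (h1 : TailDecay (deriv F)) (r : ℝ) :
    ∫ s in Ioi (0 : ℝ), √s * deriv F (r + s) =
      -(1 / 2) * ∫ s in Ioi (0 : ℝ), (√s)⁻¹ * F (r + s) := by
  have hFm : Measurable F := hF.continuous.measurable
  have hi := h0.integrableOn_mul hFm (w := fun s => (√s)⁻¹) (by fun_prop)
    (fun s => by positivity) integrableOn_inv_sqrt_mul_inv_cube r
  have key := integral_Ioi_mul_deriv_eq_deriv_mul (a := (0 : ℝ)) (a' := 0) (b' := 0)
    (u := fun s => √s) (v := fun s => F (r + s)) (u' := fun s => 1 / (2 * √s))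
    (v' := fun s => deriv F (r + s))
    (fun s hs => Real.hasDerivAt_sqrt (ne_of_gt hs))
    (fun s _ => HasDerivAt.comp_const_add r s (hF (r + s)).hasDerivAt)
    (h1.integrableOn_mul (measurable_deriv F) (by fun_prop) (fun s => sqrt_nonneg s)
      integrableOn_sqrt_mul_inv_cube r)
    (by
      refine (hi.const_mul (1 / 2)).congr (Filter.Eventually.of_forall fun s => ?_)
      simp only [Pi.mul_apply, one_div, mul_inv]; ring)
    (by
      have hc : Continuous ((fun s => √s) * fun s => F (r + s)) :=
        Real.continuous_sqrt.mul (hF.continuous.comp (continuous_const.add continuous_id))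
      have := hc.tendsto 0
      simp only [Pi.mul_apply, Real.sqrt_zero, zero_mul] at this
      exact this.mono_left nhdsWithin_le_nhds)
    (h0.tendsto_sqrt_mul r)
  rw [key, ← integral_const_mul, sub_zero, zero_sub, ← integral_neg]
  congr 1
  ext s
  simp only [one_div, mul_inv]; ring

theorem hasDerivAt_gfun_s8 {F : ℝ → ℝ} (hF : Differentiable ℝ F) (h0 : TailDecay F)
    (h1 : TailDecay (deriv F)) (r : ℝ) :
    HasDerivAt (gfun F) (-(2 * π * √2) * ∫ s in Ioi (0 : ℝ), (√s)⁻¹ * F (r + s)) r := by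
  have hFm : Measurable F := hF.continuous.measurable
  have hF'm := measurable_deriv F
  obtain ⟨K, hK, hb⟩ := h1 (|r| + 1) (by positivity)
  have key := hasDerivAt_integral_of_dominated_loc_of_deriv_le
    (μ := volume.restrict (Ioi (0 : ℝ))) (x₀ := r)
    (F := fun r s => √s * F (r + s)) (F' := fun r s => √s * deriv F (r + s))
    (bound := fun s => K * (√s * ((1 + s) ^ 3)⁻¹)) (Metric.ball_mem_nhds r one_pos)
    (Filter.Eventually.of_forall fun x => by fun_prop)
    (h0.integrableOn_mul hFm (by fun_prop) (fun s => sqrt_nonneg s)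
      integrableOn_sqrt_mul_inv_cube r)
    (by fun_prop)
    (by
      filter_upwards [self_mem_ae_restrict measurableSet_Ioi] with s hs x hx
      rw [norm_mul, Real.norm_eq_abs, Real.norm_eq_abs, abs_of_nonneg (sqrt_nonneg s)]
      rw [Metric.mem_ball, Real.dist_eq] at hx
      have := hb s (le_of_lt hs) (x + s) (by linarith [neg_abs_le r, neg_abs_le (x - r)])
      calc √s * |deriv F (x + s)| ≤ √s * (K * ((1 + s) ^ 3)⁻¹) := by gcongr
        _ = _ := by ring)
    (integrableOn_sqrt_mul_inv_cube.const_mul K)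
    (Filter.Eventually.of_forall fun s x _ =>
      (HasDerivAt.comp_add_const x s (hF (x + s)).hasDerivAt).const_mul (√s))
  have := key.2.const_mul (4 * π * √2)
  rw [integral_sqrt_mul_deriv hF h0 h1] at this
  exact this.congr_deriv (by ring)

theorem integrableOn_Ioc_inv_sqrt (R : ℝ) (hR : 0 ≤ R) :
    IntegrableOn (fun s : ℝ => (√s)⁻¹) (Ioc 0 R) ∧
      ∫ s in Ioc 0 R, (√s)⁻¹ = 2 * R ^ (1 / 2 : ℝ) := by
  have h := (intervalIntegral.intervalIntegrable_rpow' (a := 0) (b := R)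
    (r := (-(1 / 2) : ℝ)) (by norm_num))
  have he : EqOn (fun s : ℝ => s ^ (-(1 / 2) : ℝ)) (fun s : ℝ => (√s)⁻¹) (Ioc 0 R) :=
    fun s hs => (inv_sqrt_eq_rpow hs.1.le).symm
  refine ⟨h.1.congr_fun he measurableSet_Ioc, ?_⟩
  rw [← setIntegral_congr_fun measurableSet_Ioc he, ← intervalIntegral.integral_of_le hR,
    integral_rpow (Or.inl (by norm_num)), Real.zero_rpow (by norm_num)]
  norm_num
  ring

theorem integrableOn_Ioc_sub_rpow {β R : ℝ} (hβ : β < 1) (hR : 0 ≤ R) :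
    IntegrableOn (fun s : ℝ => (R - s) ^ (-β)) (Ioc 0 R) ∧
      ∫ s in Ioc 0 R, (R - s) ^ (-β) = R ^ (1 - β) / (1 - β) := by
  have h := (intervalIntegral.intervalIntegrable_rpow' (a := R) (b := 0)
    (r := -β) (by linarith)).comp_sub_left R
  rw [sub_self, sub_zero] at h
  refine ⟨h.1, ?_⟩
  rw [← intervalIntegral.integral_of_le hR,
    intervalIntegral.integral_comp_sub_left (fun x => x ^ (-β)) R, sub_self, sub_zero,
    integral_rpow (Or.inl (by linarith)), Real.zero_rpow (by linarith)]
  rw [sub_zero, neg_add_eq_sub]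

theorem inv_sqrt_mul_sub_rpow_le {β R s : ℝ} (hβ : 0 ≤ β) (hs : 0 < s) (hsR : s < R) :
    (√s)⁻¹ * (R - s) ^ (-β) ≤ (R / 2) ^ (-β) * (√s)⁻¹ + (√(R / 2))⁻¹ * (R - s) ^ (-β) := by
  have hR : 0 < R / 2 := by linarith
  have hRs : 0 < R - s := by linarith
  rcases le_total s (R / 2) with h | h
  · have : (R - s) ^ (-β) ≤ (R / 2) ^ (-β) :=
      Real.rpow_le_rpow_of_nonpos hR (by linarith) (by linarith)
    have h2 : 0 ≤ (√(R / 2))⁻¹ * (R - s) ^ (-β) := by positivity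
    have h3 : (√s)⁻¹ * (R - s) ^ (-β) ≤ (√s)⁻¹ * (R / 2) ^ (-β) := by gcongr
    linarith
  · have : (√s)⁻¹ ≤ (√(R / 2))⁻¹ := by gcongr
    have h2 : 0 ≤ (R / 2) ^ (-β) * (√s)⁻¹ := by positivity
    have h3 : (√s)⁻¹ * (R - s) ^ (-β) ≤ (√(R / 2))⁻¹ * (R - s) ^ (-β) := by gcongr
    linarith

/-- Growth at `-∞` of the Abel transform of a function which is `O(|x| ^ (-β))` at `-∞`. -/
theorem TailDecay.integral_inv_sqrt_mul_le {F : ℝ → ℝ} {β K : ℝ} (h : TailDecay F)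
    (hβ : 0 ≤ β) (hβ' : β ≤ 1 / 2) (hK : 0 ≤ K)
    (hneg : ∀ x, x < 0 → |F x| ≤ K * (-x) ^ (-β)) :
    ∃ C, 0 ≤ C ∧ ∀ R, 1 ≤ R →
      |∫ s in Ioi (0 : ℝ), (√s)⁻¹ * F (-R + s)| ≤ C * R ^ (1 / 2 - β) := by
  obtain ⟨L, hL, hb⟩ := h 0 le_rfl
  set J : ℝ := ∫ s : ℝ, ((1 + |s|) ^ 3)⁻¹ with hJ
  have hJ0 : 0 ≤ J := integral_nonneg fun s => by positivity
  have hJi := integrable_inv_one_add_abs_pow (n := 3) (by norm_num)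
  have hβ1 : 0 < 1 - β := by linarith
  refine ⟨K * (2 * (1 / 2) ^ (-β) + (1 / 2) ^ (-(1 / 2) : ℝ) / (1 - β)) + L * J,
    by positivity, fun R hR => ?_⟩
  have hR0 : 0 < R := by linarith
  obtain ⟨hi1, hv1⟩ := integrableOn_Ioc_inv_sqrt R hR0.le
  obtain ⟨hi2, hv2⟩ := integrableOn_Ioc_sub_rpow (β := β) (by linarith) hR0.le
  set p : ℝ → ℝ := fun s => K * ((R / 2) ^ (-β) * (√s)⁻¹ + (√(R / 2))⁻¹ * (R - s) ^ (-β))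
    with hp
  have hpi : IntegrableOn p (Ioc 0 R) := ((hi1.const_mul _).add (hi2.const_mul _)).const_mul K
  have hpv : ∫ s in Ioc 0 R, p s =
      K * (2 * (1 / 2) ^ (-β) + (1 / 2) ^ (-(1 / 2) : ℝ) / (1 - β)) * R ^ (1 / 2 - β) := by
    rw [hp, integral_const_mul, integral_add (hi1.const_mul _) (hi2.const_mul _),
      integral_const_mul, integral_const_mul, hv1, hv2, inv_sqrt_eq_rpow (by positivity),
      div_eq_mul_one_div R 2, Real.mul_rpow hR0.le (by norm_num),
      Real.mul_rpow hR0.le (by norm_num)]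
    have e1 : R ^ (1 / 2 - β) = R ^ (-β) * R ^ (1 / 2 : ℝ) := by
      rw [← Real.rpow_add hR0]; ring_nf
    have e2 : R ^ (1 / 2 - β) = R ^ (-(1 / 2) : ℝ) * R ^ (1 - β) := by
      rw [← Real.rpow_add hR0]; ring_nf
    rw [mul_assoc K, add_mul]
    nth_rewrite 1 [e1]
    rw [e2]
    ring
  have hqi : Integrable (fun s : ℝ => L * ((1 + |s - R|) ^ 3)⁻¹) :=
    (hJi.comp_sub_right R).const_mul L
  have hqv : ∫ s in Ioi (0 : ℝ), L * ((1 + |s - R|) ^ 3)⁻¹ ≤ L * J := by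
    rw [hJ, ← integral_sub_right_eq_self (fun s : ℝ => ((1 + |s|) ^ 3)⁻¹) R,
      ← integral_const_mul]
    exact setIntegral_le_integral hqi (Filter.Eventually.of_forall fun s => by
      simp only [Pi.zero_apply]; positivity)
  have hp0 : ∀ s ∈ Ioc 0 R, 0 ≤ p s := fun s hs => by
    have : 0 ≤ R - s := by linarith [hs.2]
    simp only [hp]; positivity
  have hpI : IntegrableOn ((Ioc 0 R).indicator p) (Ioi 0) :=
    ((integrable_indicator_iff measurableSet_Ioc).2 hpi).integrableOn
  have hpIv : ∫ s in Ioi 0, (Ioc 0 R).indicator p s = ∫ s in Ioc 0 R, p s := by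
    rw [setIntegral_indicator measurableSet_Ioc, inter_eq_self_of_subset_right Ioc_subset_Ioi_self]
  have hpt : ∀ s ∈ Ioi (0 : ℝ), ‖(√s)⁻¹ * F (-R + s)‖ ≤
      (Ioc 0 R).indicator p s + L * ((1 + |s - R|) ^ 3)⁻¹ := fun s hs => by
    have hs : 0 < s := hs
    rw [norm_mul, Real.norm_eq_abs, Real.norm_eq_abs, abs_of_nonneg (by positivity : 0 ≤ (√s)⁻¹)]
    rcases lt_or_ge s R with hsR | hsR
    · have hm : s ∈ Ioc 0 R := ⟨hs, hsR.le⟩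
      rw [indicator_of_mem hm]
      have h1 := hneg (-R + s) (by linarith)
      rw [show -(-R + s) = R - s by ring] at h1
      calc (√s)⁻¹ * |F (-R + s)| ≤ (√s)⁻¹ * (K * (R - s) ^ (-β)) := by gcongr
        _ = K * ((√s)⁻¹ * (R - s) ^ (-β)) := by ring
        _ ≤ p s := mul_le_mul_of_nonneg_left (inv_sqrt_mul_sub_rpow_le hβ hs hsR) hK
        _ ≤ _ := le_add_of_nonneg_right (by positivity)
    · have h1 := hb (s - R) (by linarith) (-R + s) (by linarith)
      have h2 : (√s)⁻¹ ≤ 1 := inv_le_one_of_one_le₀ (Real.one_le_sqrt.2 (by linarith))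
      rw [abs_of_nonneg (by linarith : 0 ≤ s - R)]
      calc (√s)⁻¹ * |F (-R + s)| ≤ |F (-R + s)| := mul_le_of_le_one_left (abs_nonneg _) h2
        _ ≤ _ := h1
        _ ≤ _ := le_add_of_nonneg_left (indicator_nonneg hp0 s)
  calc |∫ s in Ioi (0 : ℝ), (√s)⁻¹ * F (-R + s)|
      ≤ ∫ s in Ioi (0 : ℝ), ((Ioc 0 R).indicator p s + L * ((1 + |s - R|) ^ 3)⁻¹) :=
        norm_integral_le_of_norm_le (hpI.add hqi.integrableOn)
          ((ae_restrict_iff' measurableSet_Ioi).2 (Filter.Eventually.of_forall hpt))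
    _ ≤ K * (2 * (1 / 2) ^ (-β) + (1 / 2) ^ (-(1 / 2) : ℝ) / (1 - β)) * R ^ (1 / 2 - β)
          + L * J := by
        rw [integral_add hpI hqi.integrableOn, hpIv, hpv]
        gcongr
    _ ≤ _ := by
        have : 1 ≤ R ^ (1 / 2 - β) := Real.one_le_rpow hR (by linarith)
        have h2 : 0 ≤ L * J := by positivity
        nlinarith

theorem abs_integral_inv_sqrt_mul_le {G : ℝ → ℝ} {M : ℝ}
    (hG : ∀ s, 0 ≤ s → |G s| ≤ M * ((1 + s) ^ 3)⁻¹) :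
    |∫ s in Ioi (0 : ℝ), (√s)⁻¹ * G s| ≤
      M * ∫ s in Ioi (0 : ℝ), (√s)⁻¹ * ((1 + s) ^ 3)⁻¹ := by
  rw [← integral_const_mul, ← Real.norm_eq_abs]
  refine norm_integral_le_of_norm_le (integrableOn_inv_sqrt_mul_inv_cube.const_mul M) ?_
  filter_upwards [self_mem_ae_restrict measurableSet_Ioi] with s hs
  rw [norm_mul, Real.norm_eq_abs, Real.norm_eq_abs, abs_of_nonneg (by positivity : 0 ≤ (√s)⁻¹)]
  calc (√s)⁻¹ * |G s| ≤ (√s)⁻¹ * (M * ((1 + s) ^ 3)⁻¹) := by gcongr; exact hG s (le_of_lt hs)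
    _ = _ := by ring

theorem TailDecay.abs_integral_inv_sqrt_mul_sub_le {F : ℝ → ℝ} {β K : ℝ}
    (hF : Differentiable ℝ F) (h0 : TailDecay F) (h1 : TailDecay (deriv F))
    (hβ : 0 ≤ β) (hβ' : β ≤ 1 / 2) (hK : 0 ≤ K)
    (hneg : ∀ x, x < 0 → |F x| ≤ K * (-x) ^ (-β)) :
    ∃ C, 0 ≤ C ∧ ∀ r : ℝ,
      |(∫ s in Ioi (0 : ℝ), (√s)⁻¹ * F (r + s)) - ∫ s in Ioi (0 : ℝ), (√s)⁻¹ * F (0 + s)| ≤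
        C * |r| ^ (1 / 2 - β) := by
  have hFm : Measurable F := hF.continuous.measurable
  obtain ⟨A, hA, hneg'⟩ := h0.integral_inv_sqrt_mul_le hβ hβ' hK hneg
  obtain ⟨L, hL, hb⟩ := h0 0 le_rfl
  obtain ⟨M, hM, hb'⟩ := h1 1 zero_le_one
  set I : ℝ := ∫ s in Ioi (0 : ℝ), (√s)⁻¹ * ((1 + s) ^ 3)⁻¹ with hI
  have hI0 : 0 ≤ I := setIntegral_nonneg measurableSet_Ioi fun s hs => by
    have : 0 < s := hs
    positivity
  have hright : ∀ r, 0 ≤ r → |∫ s in Ioi (0 : ℝ), (√s)⁻¹ * F (r + s)| ≤ L * I := fun r hr =>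
    abs_integral_inv_sqrt_mul_le fun s hs => hb s hs (r + s) (by linarith)
  have hzero := hright 0 le_rfl
  have hLI : 0 ≤ L * I := by positivity
  have hMI : 0 ≤ M * I := by positivity
  refine ⟨A + 2 * (L * I) + M * I, by positivity, fun r => ?_⟩
  rcases le_total |r| 1 with hr | hr
  · have hint : ∀ r, IntegrableOn (fun s => (√s)⁻¹ * F (r + s)) (Ioi 0) :=
      h0.integrableOn_mul hFm (w := fun s => (√s)⁻¹) (by fun_prop)
        (fun s => by positivity) integrableOn_inv_sqrt_mul_inv_cube
    rw [← integral_sub (hint r) (hint 0)]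
    simp_rw [← mul_sub]
    have hlip : ∀ s, 0 ≤ s → |F (r + s) - F (0 + s)| ≤ |r| * M * ((1 + s) ^ 3)⁻¹ :=
      fun s hs => by
        have := (convex_Ici (s - 1)).norm_image_sub_le_of_norm_hasDerivWithin_le
          (s := Ici (s - 1)) (f := F) (f' := deriv F) (C := M * ((1 + s) ^ 3)⁻¹) (x := 0 + s) (y := r + s)
          (fun x _ => (hF x).hasDerivAt.hasDerivWithinAt) (fun x hx => hb' s hs x hx)
          (by simp) (by simp only [mem_Ici]; linarith [neg_abs_le r])
        simp only [Real.norm_eq_abs, zero_add, add_sub_cancel_right] at this ⊢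
        linarith
    have h := abs_integral_inv_sqrt_mul_le hlip
    have hpow : |r| ≤ |r| ^ (1 / 2 - β) := by
      simpa using Real.rpow_le_rpow_of_exponent_ge' (abs_nonneg r) hr
        (by linarith : 0 ≤ 1 / 2 - β) (by linarith : 1 / 2 - β ≤ 1)
    calc _ ≤ |r| * M * I := h
      _ = M * I * |r| := by ring
      _ ≤ (A + 2 * (L * I) + M * I) * |r| ^ (1 / 2 - β) := by gcongr; linarith
  · have hpow : 1 ≤ |r| ^ (1 / 2 - β) := Real.one_le_rpow hr (by linarith)
    have hmain : |∫ s in Ioi (0 : ℝ), (√s)⁻¹ * F (r + s)| ≤ (A + L * I) * |r| ^ (1 / 2 - β) := by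
      rcases le_total 0 r with h | h
      · refine (hright r h).trans ?_
        nlinarith
      · have := hneg' (-r) (by rwa [abs_of_nonpos h] at hr)
        rw [neg_neg] at this
        rw [abs_of_nonpos h] at hpow ⊢
        nlinarith
    refine (abs_sub _ _).trans ?_
    nlinarith

/-- Hölder-type control of the derivative integrates to control of the Taylor remainder. -/
theorem sub_taylor_le_of_abs_deriv_sub_le {g : ℝ → ℝ} {γ C : ℝ} (hg : Differentiable ℝ g)
    (hγ : 0 ≤ γ) (hC : 0 ≤ C) (h : ∀ r, |deriv g r - deriv g 0| ≤ C * |r| ^ γ) (r : ℝ) :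
    |g r - (g 0 + deriv g 0 * r)| ≤ C * |r| ^ (γ + 1) := by
  have key := (convex_uIcc 0 r).norm_image_sub_le_of_norm_hasDerivWithin_le
    (f := fun x => g x - deriv g 0 * x) (f' := fun x => deriv g x - deriv g 0)
    (C := C * |r| ^ γ) (x := 0) (y := r)
    (fun x _ => ((hg x).hasDerivAt.sub
      (by simpa using (hasDerivAt_id x).const_mul (deriv g 0))).hasDerivWithinAt)
    (fun x hx => (h x).trans (by
      have : |x| ≤ |r| := by simpa using abs_sub_left_of_mem_uIcc hx
      gcongr))
    left_mem_uIcc right_mem_uIcc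
  simp only [Real.norm_eq_abs, sub_zero, mul_zero] at key
  rw [Real.rpow_add_one' (abs_nonneg r) (by positivity), ← mul_assoc]
  convert key using 2
  ring

/-- The formula defining `Fbc` on the negative half-line. -/
def leftBranch (β c a b x : ℝ) : ℝ :=
  c * x ^ 2 / (1 + x ^ 2) ^ ((β + 2) / 2) + Real.exp (-x ^ 2) * (a + b * x)

theorem contDiff_leftBranch (β c a b : ℝ) : ContDiff ℝ 1 (leftBranch β c a b) := by
  have h : ∀ x : ℝ, (1 + x ^ 2) ≠ 0 := fun x => by positivity
  have h' : ∀ x : ℝ, (1 + x ^ 2) ^ ((β + 2) / 2) ≠ 0 := fun x => by positivity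
  refine ContDiff.add (ContDiff.div (by fun_prop) ?_ h') (by fun_prop)
  exact ContDiff.rpow_const_of_ne (by fun_prop) h

theorem hasDerivAt_leftBranch_zero (β c a b : ℝ) : HasDerivAt (leftBranch β c a b) b 0 := by
  have hd : DifferentiableAt ℝ (fun x : ℝ => ((1 + x ^ 2) ^ ((β + 2) / 2))⁻¹) 0 := by
    refine DifferentiableAt.inv (DifferentiableAt.rpow_const (by fun_prop) (Or.inl ?_)) ?_ <;>
      norm_num
  have h1 : HasDerivAt (fun x : ℝ => c * x ^ 2) 0 0 := by
    simpa using (hasDerivAt_pow 2 (0 : ℝ)).const_mul c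
  have h2 : HasDerivAt (fun x : ℝ => Real.exp (-x ^ 2)) 0 0 := by
    simpa using ((hasDerivAt_pow 2 (0 : ℝ)).fun_neg).exp
  have h3 : HasDerivAt (fun x : ℝ => a + b * x) b 0 := by
    simpa using ((hasDerivAt_id (0 : ℝ)).const_mul b).const_add a
  have h := (h1.mul hd.hasDerivAt).add (h2.mul h3)
  exact (h.congr_deriv (by simp)).congr_of_eventuallyEq
    (Filter.Eventually.of_forall fun x => by simp [leftBranch, div_eq_mul_inv])

theorem abs_leftBranch_le {β c : ℝ} (hβ : 0 ≤ β) (hβ' : β ≤ 1) (hc : 0 ≤ c) (a b : ℝ) {x : ℝ}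
    (hx : x < 0) :
    |leftBranch β c a b x| ≤ (c + 2 * (|a| + |b|)) * (-x) ^ (-β) := by
  obtain ⟨y, rfl⟩ : ∃ y, x = -y := ⟨-x, by ring⟩
  have hy : 0 < y := by linarith
  rw [neg_neg]
  have hrec : y ^ β * y ^ (-β) = 1 := by rw [← Real.rpow_add hy]; simp
  have hpos : 0 < y ^ (-β) := by positivity
  have h1 : |c * (-y) ^ 2 / (1 + (-y) ^ 2) ^ ((β + 2) / 2)| ≤ c * y ^ (-β) := by
    rw [abs_of_nonneg (by positivity), neg_sq, div_le_iff₀ (by positivity), mul_assoc]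
    gcongr
    have : y ^ (β + 2) ≤ (1 + y ^ 2) ^ ((β + 2) / 2) := by
      calc y ^ (β + 2) = (y ^ 2) ^ ((β + 2) / 2) := by
            rw [← Real.rpow_natCast, ← Real.rpow_mul hy.le]; congr 1; push_cast; ring
        _ ≤ _ := by gcongr; linarith
    calc y ^ 2 = y ^ (-β) * y ^ (β + 2) := by
          rw [← Real.rpow_add hy, neg_add_cancel_left]; norm_cast
      _ ≤ _ := by gcongr
  have h2 : |Real.exp (-(-y) ^ 2) * (a + b * -y)| ≤ 2 * (|a| + |b|) * y ^ (-β) := by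
    have hyβ : y ^ β ≤ 1 + y := by
      calc y ^ β ≤ (1 + y) ^ β := by gcongr; linarith
        _ ≤ (1 + y) ^ (1 : ℝ) := Real.rpow_le_rpow_of_exponent_le (by linarith) hβ'
        _ = _ := Real.rpow_one _
    have hexp : Real.exp (-(-y) ^ 2) * (1 + y ^ 2) ≤ 1 := by
      rw [neg_sq, Real.exp_neg, inv_mul_le_iff₀ (Real.exp_pos _), mul_one]
      linarith [Real.add_one_le_exp (y ^ 2)]
    have hlin : |a + b * -y| ≤ (|a| + |b|) * (1 + y) := by
      refine (abs_add_le _ _).trans ?_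
      rw [abs_mul, abs_neg, abs_of_pos hy]
      nlinarith [abs_nonneg a, abs_nonneg b]
    rw [abs_mul, Real.abs_exp]
    calc Real.exp (-(-y) ^ 2) * |a + b * -y|
        = Real.exp (-(-y) ^ 2) * |a + b * -y| * (y ^ β * y ^ (-β)) := by rw [hrec, mul_one]
      _ ≤ Real.exp (-(-y) ^ 2) * ((|a| + |b|) * (1 + y)) * ((1 + y) * y ^ (-β)) := by gcongr
      _ = Real.exp (-(-y) ^ 2) * (1 + y) ^ 2 * ((|a| + |b|) * y ^ (-β)) := by ring
      _ ≤ 2 * ((|a| + |b|) * y ^ (-β)) := by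
          gcongr
          nlinarith [Real.exp_pos (-(-y) ^ 2), sq_nonneg (1 - y),
            mul_nonneg (Real.exp_pos (-(-y) ^ 2)).le (sq_nonneg (1 - y))]
      _ = _ := by ring
  refine (abs_add_le _ _).trans ?_
  linarith

theorem tailDecay_of_continuous_of_le {F P Q : ℝ → ℝ} {C : ℝ} (hC : 0 ≤ C) (hP : Continuous P)
    (hFP : ∀ x, x < 0 → F x = P x) (hFQ : ∀ x, 0 ≤ x → F x = Q x)
    (hQ : ∀ x, 0 ≤ x → |Q x| ≤ C / (1 + x ^ 3)) : TailDecay F := by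
  intro a ha
  obtain ⟨B, hB⟩ := (isCompact_Icc (a := -a) (b := 0)).exists_bound_of_continuousOn hP.continuousOn
  have hB0 : 0 ≤ B := (norm_nonneg _).trans (hB 0 ⟨by linarith, le_rfl⟩)
  refine ⟨(B + 4 * C) * (1 + a) ^ 3, by positivity, fun s hs x hx => ?_⟩
  rw [← div_eq_mul_inv, le_div_iff₀ (by positivity)]
  rcases lt_or_ge x 0 with h | h
  · rw [hFP x h]
    have h1 : |P x| ≤ B := hB x ⟨by linarith, h.le⟩
    have h2 : (1 + s) ^ 3 ≤ (1 + a) ^ 3 := by gcongr; linarith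
    calc |P x| * (1 + s) ^ 3 ≤ B * (1 + a) ^ 3 := by gcongr
      _ ≤ _ := by gcongr; linarith
  · rw [hFQ x h]
    have h1 : |Q x| * (1 + x ^ 3) ≤ C := (le_div_iff₀ (by positivity)).1 (hQ x h)
    have h2 : (1 + s) ^ 3 ≤ ((1 + a) * (1 + x)) ^ 3 := by gcongr; nlinarith
    have h3 : (1 + x) ^ 3 ≤ 4 * (1 + x ^ 3) := by
      nlinarith [mul_nonneg (by linarith : 0 ≤ 1 + x) (sq_nonneg (1 - x))]
    calc |Q x| * (1 + s) ^ 3 ≤ |Q x| * ((1 + a) * (1 + x)) ^ 3 := by gcongr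
      _ = |Q x| * (1 + x) ^ 3 * (1 + a) ^ 3 := by ring
      _ ≤ |Q x| * (4 * (1 + x ^ 3)) * (1 + a) ^ 3 := by gcongr
      _ = 4 * (|Q x| * (1 + x ^ 3)) * (1 + a) ^ 3 := by ring
      _ ≤ 4 * C * (1 + a) ^ 3 := by gcongr
      _ ≤ _ := by gcongr; linarith

theorem Fbc_of_neg {F0 F0' : ℝ → ℝ} {β c x : ℝ} (hx : x < 0) :
    Fbc F0 F0' β c x = leftBranch β c (F0 0) (F0' 0) x := by
  rw [Fbc, if_neg hx.not_ge, leftBranch]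

theorem Fbc_of_nonneg {F0 F0' : ℝ → ℝ} {β c x : ℝ} (hx : 0 ≤ x) :
    Fbc F0 F0' β c x = F0 x := by
  rw [Fbc, if_pos hx]

theorem hasDerivAt_Fbc_of_neg {F0 F0' : ℝ → ℝ} {β c x : ℝ} (hx : x < 0) :
    HasDerivAt (Fbc F0 F0' β c) (deriv (leftBranch β c (F0 0) (F0' 0)) x) x := by
  have h := ((contDiff_leftBranch β c (F0 0) (F0' 0)).differentiable one_ne_zero x).hasDerivAt
  exact h.congr_of_eventuallyEq
    ((eventually_lt_nhds hx).mono fun y hy => Fbc_of_neg hy)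

theorem hasDerivAt_Fbc_of_nonneg {F0 F0' : ℝ → ℝ} {β c x : ℝ}
    (hF0 : ∀ r, 0 ≤ r → HasDerivWithinAt F0 (F0' r) (Ici 0) r) (hx : 0 ≤ x) :
    HasDerivAt (Fbc F0 F0' β c) (F0' x) x := by
  have hright : HasDerivWithinAt (Fbc F0 F0' β c) (F0' x) (Ici 0) x :=
    (hF0 x hx).congr (fun y hy => Fbc_of_nonneg hy) (Fbc_of_nonneg hx)
  rcases hx.eq_or_lt with rfl | hx
  · have h0 : Fbc F0 F0' β c 0 = leftBranch β c (F0 0) (F0' 0) 0 := by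
      simp [Fbc, leftBranch]
    have hleft : HasDerivWithinAt (Fbc F0 F0' β c) (F0' 0) (Iic 0) 0 := by
      refine (hasDerivAt_leftBranch_zero β c (F0 0) (F0' 0)).hasDerivWithinAt.congr
        (fun y hy => ?_) h0
      rcases (show y ≤ 0 from hy).eq_or_lt with rfl | hy
      · exact h0
      · exact Fbc_of_neg hy
    have := hleft.union hright
    rwa [Iic_union_Ici, hasDerivWithinAt_univ] at this
  · exact hright.hasDerivAt (Ici_mem_nhds hx)

/-- Step 5 of Lemma 2.1 (growth condition): with α = 3/2 − β, the function g_{β,c}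
satisfies g_{β,c}(r) − (g_{β,c}(0) + g_{β,c}'(0)r) ≤ C₁|r|^α and
|g_{β,c}'(r) − g_{β,c}'(0)| ≤ C₂|r|^{α−1} for all r ∈ ℝ. -/
theorem gfun_growth_condition
    (F0 F0' : ℝ → ℝ) (β c : ℝ)
    (hF0 : AssumptionA F0 F0') (hβ : 0 < β) (hβ' : β < 1 / 2) (hc : 0 < c) :
    ∃ C₁ : ℝ, 0 < C₁ ∧ ∃ C₂ : ℝ, 0 < C₂ ∧ ∀ r : ℝ,
      gfun (Fbc F0 F0' β c) r -
          (gfun (Fbc F0 F0' β c) 0 + deriv (gfun (Fbc F0 F0' β c)) 0 * r) ≤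
        C₁ * |r| ^ (3 / 2 - β) ∧
      |deriv (gfun (Fbc F0 F0' β c)) r - deriv (gfun (Fbc F0 F0' β c)) 0| ≤
        C₂ * |r| ^ (3 / 2 - β - 1) := by
  obtain ⟨-, hd, -, -, ⟨C, hC, hdecay⟩, -⟩ := hF0
  set F := Fbc F0 F0' β c with hFdef
  have hcd := contDiff_leftBranch β c (F0 0) (F0' 0)
  have hF : Differentiable ℝ F := fun x => by
    rcases lt_or_ge x 0 with hx | hx
    · exact (hasDerivAt_Fbc_of_neg hx).differentiableAt
    · exact (hasDerivAt_Fbc_of_nonneg hd hx).differentiableAt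
  have h0 : TailDecay F := tailDecay_of_continuous_of_le hC.le hcd.continuous
    (fun x => Fbc_of_neg) (fun x => Fbc_of_nonneg)
    (fun x hx => (le_add_of_nonneg_right (abs_nonneg _)).trans (hdecay x hx))
  have h1 : TailDecay (deriv F) := tailDecay_of_continuous_of_le hC.le
    (hcd.continuous_deriv le_rfl)
    (fun x hx => (hasDerivAt_Fbc_of_neg hx).deriv)
    (fun x hx => (hasDerivAt_Fbc_of_nonneg hd hx).deriv)
    (fun x hx => (le_add_of_nonneg_left (abs_nonneg _)).trans (hdecay x hx))
  obtain ⟨A, hA, hbound⟩ := h0.abs_integral_inv_sqrt_mul_sub_le hF h1 hβ.le hβ'.le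
    (by positivity : 0 ≤ c + 2 * (|F0 0| + |F0' 0|)) (fun x hx => by
      rw [hFdef, Fbc_of_neg hx]
      exact abs_leftBranch_le hβ.le (by linarith) hc.le _ _ hx)
  have hg := hasDerivAt_gfun_s8 hF h0 h1
  have hderiv : ∀ r, |deriv (gfun F) r - deriv (gfun F) 0| ≤
      (2 * π * √2 * A + 1) * |r| ^ (1 / 2 - β) := fun r => by
    rw [(hg r).deriv, (hg 0).deriv, ← mul_sub, abs_mul, abs_neg,
      abs_of_nonneg (by positivity : 0 ≤ 2 * π * √2)]
    have h2 : 0 ≤ |r| ^ (1 / 2 - β) := by positivity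
    have h3 := mul_le_mul_of_nonneg_left (hbound r) (by positivity : 0 ≤ 2 * π * √2)
    linarith
  have hpos : 0 < 2 * π * √2 * A + 1 := by positivity
  refine ⟨_, hpos, _, hpos, fun r => ⟨?_, ?_⟩⟩
  · have := sub_taylor_le_of_abs_deriv_sub_le (fun x => (hg x).differentiableAt)
      (by linarith) hpos.le hderiv r
    rw [show 1 / 2 - β + 1 = 3 / 2 - β by ring] at this
    exact (le_abs_self _).trans this
  · rw [show 3 / 2 - β - 1 = 1 / 2 - β by ring]
    exact hderiv r

end
end
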